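/- The average cardinality of the level sets of the Takagi function is infinite: the Lebesgue integral over [0, 2/3] of the extended cardinality of L(y) diverges, i.e. ∫_{[0,2/3]} |L(y)| dy = ∞ (where |L(y)| ∈ ℕ∪{∞} is the extended cardinality of L(y), and the integral is the lower Lebesgue integral with values in [0,∞]). -/

import Mathlib

open Set MeasureTheory ENNReal

/-- `phi x` is the distance from `x` to the nearest integer. -/
noncomputable def phi (x : ℝ) : ℝ := |x - (round x : ℤ)|

/-- The Takagi function. -/
noncomputable def T (x : ℝ) : ℝ := ∑' n : ℕ, phi (2 ^ n * x) / 2 ^ n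

/-- The `n`-th binary digit of `x` (terminating expansion for dyadic rationals). -/
noncomputable def eps (n : ℕ) (x : ℝ) : ℤ := ⌊2 ^ n * x⌋ - 2 * ⌊2 ^ (n - 1) * x⌋

/-- `D k x = ∑_{j=1}^k (-1)^{ε_j(x)}`, the excess of 0 digits over 1 digits. -/
noncomputable def D (k : ℕ) (x : ℝ) : ℤ := ∑ j ∈ Finset.Icc 1 k, (1 - 2 * eps j x)

/-- The level set of the Takagi function at level `y`. -/
def L (y : ℝ) : Set ℝ := {x | x ∈ Set.Icc (0:ℝ) 1 ∧ T x = y}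

/-- `x` is a balanced dyadic rational of order `m`. -/
def BalancedOfOrder (x : ℝ) (m : ℕ) : Prop :=
  x ∈ Set.Ico (0:ℝ) 1 ∧ (∃ k : ℤ, x = (k : ℝ) / 2 ^ (2 * m)) ∧ D (2 * m) x = 0

/-- The generation of a balanced dyadic rational of order `m`:
the number of indices `1 ≤ j ≤ 2m` with `D j x = 0`. -/
noncomputable def generation (x : ℝ) (m : ℕ) : ℕ :=
  ((Finset.Icc 1 (2 * m)).filter (fun j => D j x = 0)).card

/-- A balanced dyadic rational of order `m` is leading if `D j x ≥ 0` for all `1 ≤ j ≤ 2m`. -/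
def Leading (x : ℝ) (m : ℕ) : Prop := ∀ j ∈ Finset.Icc 1 (2 * m), 0 ≤ D j x

/-- The equivalence relation whose classes are the local level sets. -/
def locSetoid : Setoid ℝ where
  r x x' := ∀ n : ℕ, 1 ≤ n → |D n x| = |D n x'|
  iseqv := ⟨fun _ _ _ => rfl, fun h n hn => (h n hn).symm,
    fun h g n hn => (h n hn).trans (g n hn)⟩

/-- The set of local level sets contained in `L y`: the image of `L y ∩ [0,1)`
under the quotient map of `locSetoid`. -/
def locClasses (y : ℝ) : Set (Quotient locSetoid) :=
  Quotient.mk locSetoid '' (L y ∩ Set.Ico (0:ℝ) 1)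

theorem phi_nonneg (x : ℝ) : 0 ≤ phi x := abs_nonneg _

theorem phi_le_half (x : ℝ) : phi x ≤ 1 / 2 := abs_sub_round x

theorem phi_le_abs_sub_intCast (x : ℝ) (z : ℤ) : phi x ≤ |x - z| := round_le x z

theorem continuous_phi : Continuous phi := by
  refine (LipschitzWith.of_le_add (f := phi) fun x y => ?_).continuous
  calc phi x ≤ |x - round y| := phi_le_abs_sub_intCast x _
    _ ≤ |x - y| + |y - round y| := abs_sub_le _ _ _
    _ = phi y + dist x y := by rw [Real.dist_eq, phi, add_comm]

theorem phi_eq_self {x : ℝ} (h0 : 0 ≤ x) (h1 : x ≤ 1 / 2) : phi x = x := by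
  rw [phi, abs_sub_round_eq_min, Int.fract_eq_self.2 ⟨h0, by linarith⟩]
  exact min_eq_left (by linarith)

theorem phi_eq_one_sub {x : ℝ} (h0 : 1 / 2 ≤ x) (h1 : x ≤ 1) : phi x = 1 - x := by
  rcases h1.eq_or_lt with rfl | h1
  · simp [phi]
  · rw [phi, abs_sub_round_eq_min, Int.fract_eq_self.2 ⟨by linarith, h1⟩]
    exact min_eq_right (by linarith)

theorem phi_add_phi_two_mul_div_two_le (x : ℝ) : phi x + phi (2 * x) / 2 ≤ 1 / 2 := by
  have h := phi_le_half x
  have hl := phi_le_abs_sub_intCast (2 * x) (2 * round x + 1)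
  have hr := phi_le_abs_sub_intCast (2 * x) (2 * round x - 1)
  push_cast at hl hr
  rw [phi] at h ⊢
  rcases abs_cases (x - round x) with ⟨e, _⟩ | ⟨e, _⟩ <;> rw [e] at h ⊢
  · rw [abs_of_nonpos (by linarith)] at hl
    linarith
  · rw [abs_of_nonneg (by linarith)] at hr
    linarith

theorem phi_div_two_pow_le (n : ℕ) (x : ℝ) : phi x / 2 ^ n ≤ (1 / 2) ^ n := by
  rw [one_div, inv_pow, ← one_div]
  gcongr
  linarith [phi_le_half x]

theorem summable_takagi (x : ℝ) : Summable fun n : ℕ => phi (2 ^ n * x) / 2 ^ n :=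
  summable_geometric_two.of_nonneg_of_le (fun _ => div_nonneg (phi_nonneg _) (by positivity))
    fun n => phi_div_two_pow_le n _

theorem continuous_T : Continuous T := by
  refine continuous_tsum (fun n => ?_) summable_geometric_two fun n x => ?_
  · exact (continuous_phi.comp (by fun_prop)).div_const _
  · rw [Real.norm_of_nonneg (div_nonneg (phi_nonneg _) (by positivity))]
    exact phi_div_two_pow_le n _

theorem T_nonneg (x : ℝ) : 0 ≤ T x :=
  tsum_nonneg fun _ => div_nonneg (phi_nonneg _) (by positivity)

theorem T_le_two (x : ℝ) : T x ≤ 2 :=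
  ((summable_takagi x).tsum_le_tsum (fun n => phi_div_two_pow_le n _)
    summable_geometric_two).trans_eq tsum_geometric_two

theorem T_eq_phi_add (x : ℝ) : T x = phi x + T (2 * x) / 2 := by
  rw [T, (summable_takagi x).tsum_eq_zero_add, T, ← tsum_div_const]
  congr 1
  · simp
  · refine tsum_congr fun n => ?_
    rw [div_div, pow_succ, mul_assoc]

theorem T_le_two_thirds (x : ℝ) : T x ≤ 2 / 3 := by
  have hb : BddAbove (range T) := ⟨2, by rintro _ ⟨x, rfl⟩; exact T_le_two x⟩
  have hM : ⨆ x, T x ≤ 1 / 2 + (⨆ x, T x) / 4 := by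
    refine ciSup_le fun x => ?_
    rw [T_eq_phi_add, T_eq_phi_add (2 * x)]
    linarith [phi_add_phi_two_mul_div_two_le x, le_ciSup hb (2 * (2 * x))]
  linarith [le_ciSup hb x]

theorem phi_add_natCast (x : ℝ) (n : ℕ) : phi (x + n) = phi x := by
  simp [phi, round_add_natCast]

theorem T_add_one (x : ℝ) : T (x + 1) = T x := by
  refine tsum_congr fun n => ?_
  have h := phi_add_natCast (2 ^ n * x) (2 ^ n)
  push_cast at h
  rw [mul_add, mul_one, h]

theorem T_half {u : ℝ} (h0 : 0 ≤ u) (h1 : u ≤ 1) : T (u / 2) = u / 2 + T u / 2 := by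
  rw [T_eq_phi_add, phi_eq_self (by linarith) (by linarith), mul_div_cancel₀ _ two_ne_zero]

theorem T_half_add_half {u : ℝ} (h0 : 0 ≤ u) (h1 : u ≤ 1) :
    T (u / 2 + 1 / 2) = 1 / 2 - u / 2 + T u / 2 := by
  rw [T_eq_phi_add, phi_eq_one_sub (by linarith) (by linarith),
    show 2 * (u / 2 + 1 / 2) = u + 1 by ring, T_add_one]
  ring

/-- The variation of `x ↦ T x + a * x` along the dyadic partition of `[0, 1]` of mesh `2⁻ⁿ`. -/
noncomputable def dyadicVariation (n : ℕ) (a : ℝ) : ℝ :=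
  ∑ k ∈ Finset.range (2 ^ n), |T (((k : ℝ) + 1) / 2 ^ n) - T ((k : ℝ) / 2 ^ n) + a / 2 ^ n|

theorem dyadicVariation_zero (a : ℝ) : dyadicVariation 0 a = |a| := by
  have h := T_add_one 0
  rw [zero_add] at h
  simp [dyadicVariation, h]

theorem dyadicVariation_succ (n : ℕ) (a : ℝ) :
    dyadicVariation (n + 1) a = (dyadicVariation n (a + 1) + dyadicVariation n (a - 1)) / 2 := by
  have hN : (0 : ℝ) < 2 ^ n := by positivity
  rw [dyadicVariation, pow_succ, mul_two, Finset.sum_range_add, add_div]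
  have key : ∀ k ∈ Finset.range (2 ^ n), (k : ℝ) / 2 ^ n ≤ 1 ∧ ((k : ℝ) + 1) / 2 ^ n ≤ 1 := by
    intro k hk
    have hk' : (k : ℝ) + 1 ≤ 2 ^ n := by exact_mod_cast Finset.mem_range.1 hk
    exact ⟨(div_le_one hN).2 (by linarith), (div_le_one hN).2 hk'⟩
  congr 1
  · rw [dyadicVariation, Finset.sum_div]
    refine Finset.sum_congr rfl fun k hk => ?_
    obtain ⟨h1, h2⟩ := key k hk
    rw [pow_succ, ← div_div, ← div_div, T_half (by positivity) h1, T_half (by positivity) h2,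
      ← abs_two (α := ℝ), ← abs_div, abs_two]
    congr 1
    field_simp
    ring
  · rw [dyadicVariation, Finset.sum_div]
    refine Finset.sum_congr rfl fun k hk => ?_
    obtain ⟨h1, h2⟩ := key k hk
    have e1 : ((2 ^ n + k : ℕ) : ℝ) / 2 ^ (n + 1) = (k : ℝ) / 2 ^ n / 2 + 1 / 2 := by
      push_cast
      field_simp
      ring
    have e2 : (((2 ^ n + k : ℕ) : ℝ) + 1) / 2 ^ (n + 1) = ((k : ℝ) + 1) / 2 ^ n / 2 + 1 / 2 := by
      push_cast
      field_simp
      ring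
    rw [e1, e2, T_half_add_half (by positivity) h1, T_half_add_half (by positivity) h2,
      ← abs_two (α := ℝ), ← abs_div, abs_two]
    congr 1
    field_simp
    ring

/-- The bound comes from the second and fourth moments of the simple random walk started at `a`. -/
theorem moment_bound_le_dyadicVariation {α β : ℝ} (h : ∀ t : ℝ, α * t ^ 2 - β * t ^ 4 ≤ |t|)
    (n : ℕ) (a : ℝ) :
    α * (a ^ 2 + n) - β * (a ^ 4 + 6 * a ^ 2 * n + 3 * n ^ 2 - 2 * n) ≤ dyadicVariation n a := by
  induction n generalizing a with
  | zero => simpa [dyadicVariation_zero] using h a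
  | succ n ih =>
    rw [dyadicVariation_succ]
    push_cast
    linarith [ih (a + 1), ih (a - 1)]

theorem le_dyadicVariation_sq {m : ℕ} (hm : 0 < m) :
    2 / 5 * (m : ℝ) ≤ dyadicVariation (m ^ 2) 0 := by
  have hm' : (0 : ℝ) < m := by exact_mod_cast hm
  have hquad : ∀ t : ℝ, 0 ≤ t → t ^ 2 - 1 / 5 * t ^ 4 ≤ t := by
    intro t ht
    have : 0 ≤ 1 + 1 / 5 * t ^ 3 - t := by
      nlinarith [mul_nonneg ht (sq_nonneg (t - 4 / 3)), sq_nonneg (t - 4 / 3)]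
    nlinarith [mul_nonneg ht this]
  have hbound : ∀ t : ℝ, 1 / (m : ℝ) * t ^ 2 - 1 / (5 * (m : ℝ) ^ 3) * t ^ 4 ≤ |t| := by
    intro t
    have h := mul_le_mul_of_nonneg_left (hquad (|t| / m) (by positivity)) hm'.le
    rw [← sq_abs t, show t ^ 4 = |t| ^ 4 by rw [(show Even 4 by decide).pow_abs]]
    calc _ = m * ((|t| / m) ^ 2 - 1 / 5 * (|t| / m) ^ 4) := by field_simp
      _ ≤ m * (|t| / m) := h
      _ = |t| := by field_simp
  refine le_trans ?_ (moment_bound_le_dyadicVariation hbound (m ^ 2) 0)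
  have e : 1 / (m : ℝ) * (0 ^ 2 + ((m ^ 2 : ℕ) : ℝ)) - 1 / (5 * (m : ℝ) ^ 3) *
      (0 ^ 4 + 6 * 0 ^ 2 * ((m ^ 2 : ℕ) : ℝ) + 3 * ((m ^ 2 : ℕ) : ℝ) ^ 2 - 2 * ((m ^ 2 : ℕ) : ℝ))
      = 2 / 5 * m + 2 / (5 * m) := by
    push_cast
    field_simp
    ring
  rw [e]
  have : 0 ≤ 2 / (5 * (m : ℝ)) := by positivity
  linarith

/-- Each dyadic interval whose endpoint values strictly enclose `y` contributes a point to
`L y`. -/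
theorem sum_indicator_le_encard_L (n : ℕ) (y : ℝ) :
    ∑ k ∈ Finset.range (2 ^ n),
      (uIoo (T ((k : ℝ) / 2 ^ n)) (T (((k : ℝ) + 1) / 2 ^ n))).indicator (1 : ℝ → ℝ≥0∞) y
      ≤ ((L y).encard : ℝ≥0∞) := by
  classical
  have hN : (0 : ℝ) < 2 ^ n := by positivity
  set S := (Finset.range (2 ^ n)).filter fun k : ℕ =>
    y ∈ uIoo (T ((k : ℝ) / 2 ^ n)) (T (((k : ℝ) + 1) / 2 ^ n)) with hS
  have hex : ∀ k ∈ S, ∃ x ∈ L y, ⌊2 ^ n * x⌋₊ = k := by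
    intro k hk
    obtain ⟨hk, hy⟩ := Finset.mem_filter.1 hk
    have hk' : (k : ℝ) + 1 ≤ 2 ^ n := by exact_mod_cast Finset.mem_range.1 hk
    obtain ⟨x, hx, rfl⟩ := intermediate_value_uIcc continuous_T.continuousOn
      (uIoo_subset_uIcc_self hy)
    rw [uIcc_of_le (by gcongr; linarith)] at hx
    have hx1 : x ≠ ((k : ℝ) + 1) / 2 ^ n := by
      rintro rfl
      exact right_notMem_uIoo hy
    have h1 := (div_le_iff₀ hN).1 hx.1
    have h2 := (lt_div_iff₀ hN).1 (lt_of_le_of_ne hx.2 hx1)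
    have hx0 : 0 ≤ x := le_trans (by positivity) hx.1
    refine ⟨x, ⟨⟨hx0, hx.2.trans ((div_le_one hN).2 hk')⟩, rfl⟩, ?_⟩
    rw [Nat.floor_eq_iff (by positivity)]
    exact ⟨by linarith, by linarith⟩
  choose! f hfL hf using hex
  have hinj : InjOn f S := fun a ha b hb hab => by rw [← hf a ha, ← hf b hb, hab]
  have hcard : (S.card : ℕ∞) ≤ (L y).encard := by
    rw [← encard_coe_eq_coe_finsetCard, ← hinj.encard_image]
    exact encard_le_encard (image_subset_iff.2 hfL)
  calc _ = (S.card : ℝ≥0∞) := by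
        simp only [indicator_apply, Pi.one_apply, Finset.sum_boole, hS]
    _ = ((S.card : ℕ∞) : ℝ≥0∞) := by simp
    _ ≤ _ := ENat.toENNReal_le.2 hcard

theorem measurableSet_uIoo (a b : ℝ) : MeasurableSet (uIoo a b) := measurableSet_Ioo

theorem dyadicVariation_le_lintegral_encard_L (n : ℕ) :
    ENNReal.ofReal (dyadicVariation n 0) ≤
      ∫⁻ y in Set.Icc (0:ℝ) (2/3), ((L y).encard : ℝ≥0∞) := by
  refine le_trans (le_of_eq ?_) (lintegral_mono fun y => sum_indicator_le_encard_L n y)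
  rw [lintegral_finsetSum _ fun k _ => measurable_one.indicator (measurableSet_uIoo _ _),
    dyadicVariation, ENNReal.ofReal_sum_of_nonneg fun _ _ => abs_nonneg _]
  refine Finset.sum_congr rfl fun k _ => ?_
  have hsub : uIoo (T ((k : ℝ) / 2 ^ n)) (T (((k : ℝ) + 1) / 2 ^ n)) ⊆ Set.Icc (0:ℝ) (2/3) :=
    fun y hy => ⟨(le_min (T_nonneg _) (T_nonneg _)).trans hy.1.le,
      hy.2.le.trans (max_le (T_le_two_thirds _) (T_le_two_thirds _))⟩
  rw [lintegral_indicator_one (measurableSet_uIoo _ _),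
    Measure.restrict_apply (measurableSet_uIoo _ _),
    inter_eq_self_of_subset_left hsub, uIoo, Real.volume_Ioo, max_sub_min_eq_abs, zero_div,
    add_zero]

theorem stmt7 :
    ∫⁻ y in Set.Icc (0:ℝ) (2/3), ((L y).encard : ℝ≥0∞) = ⊤ := by
  refine ENNReal.eq_top_of_forall_nnreal_le fun r => ?_
  obtain ⟨m, hm⟩ := exists_nat_gt (5 / 2 * (r : ℝ))
  have hpos : 0 < m := by
    have : (0 : ℝ) < m := lt_of_le_of_lt (by positivity) hm
    exact_mod_cast this
  rw [← ENNReal.ofReal_coe_nnreal]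
  refine (ENNReal.ofReal_le_ofReal ?_).trans (dyadicVariation_le_lintegral_encard_L (m ^ 2))
  linarith [le_dyadicVariation_sq hpos]
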